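/- Let (X, h) be an essentially minimal zero-dimensional system with X nonempty, and let f : X → ℤ be a continuous function such that f ∘ h = f. Then f is constant. -/

import Mathlib

open Set

/-- A minimal set for the restriction of the homeomorphism `h` to the invariant set `A`:
a nonempty closed `h`-invariant subset of `A` with no nonempty proper closed
`h`-invariant subset. -/
def IsMinimalSubsetOf {X : Type*} [TopologicalSpace X] (h : X ≃ₜ X) (A Y : Set X) : Prop :=
  Y.Nonempty ∧ IsClosed Y ∧ Y ⊆ A ∧ h '' Y = Y ∧
    ∀ Y' ⊆ Y, Y'.Nonempty → IsClosed Y' → h '' Y' = Y' → Y' = Y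

/-- `(X, h)` is essentially minimal: it has a unique minimal set. -/
def EssentiallyMinimal {X : Type*} [TopologicalSpace X] (h : X ≃ₜ X) : Prop :=
  ∃! Y : Set X, IsMinimalSubsetOf h Set.univ Y

theorem image_eq_self_iff_forall_mem_iff {X : Type*} (h : X ≃ X) (Y : Set X) :
    h '' Y = Y ↔ ∀ x, h x ∈ Y ↔ x ∈ Y := by
  rw [Equiv.image_eq_preimage_symm, Set.ext_iff]
  refine ⟨fun H x => ?_, fun H x => ?_⟩
  · simpa using (H (h x)).symm
  · simpa using (H (h.symm x)).symm

/-- Every nonempty closed invariant subset of a compact space contains a minimal set. -/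
theorem exists_isMinimalSubsetOf {X : Type*} [TopologicalSpace X] [CompactSpace X]
    (h : X ≃ₜ X) {A : Set X} (hne : A.Nonempty) (hcl : IsClosed A) (hinv : h '' A = A) :
    ∃ Y, IsMinimalSubsetOf h A Y := by
  obtain ⟨Y, hYA, hY⟩ := zorn_superset_nonempty
    {Y : Set X | Y.Nonempty ∧ IsClosed Y ∧ h '' Y = Y} (fun c hc hchain hcne => by
      have : Nonempty c := hcne.to_subtype
      refine ⟨⋂₀ c, ⟨?_, isClosed_sInter fun s hs => (hc hs).2.1, ?_⟩,
        fun s hs => sInter_subset_of_mem hs⟩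
      · exact IsCompact.nonempty_sInter_of_directed_nonempty_isCompact_isClosed
          (fun a ha b hb => (hchain.total ha hb).elim (fun l => ⟨a, ha, Subset.rfl, l⟩)
            fun l => ⟨b, hb, l, Subset.rfl⟩)
          (fun s hs => (hc hs).1)
          (fun s hs => (hc hs).2.1.isCompact) (fun s hs => (hc hs).2.1)
      · refine (image_eq_self_iff_forall_mem_iff h.toEquiv _).2 fun x => ?_
        refine forall₂_congr fun s hs => ?_
        exact (image_eq_self_iff_forall_mem_iff h.toEquiv s).1 (hc hs).2.2 x)
    A ⟨hne, hcl, hinv⟩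
  exact ⟨Y, hY.prop.1, hY.prop.2.1, hYA, hY.prop.2.2, fun Y' hsub h1 h2 h3 =>
    hsub.antisymm (hY.le_of_le ⟨h1, h2, h3⟩ hsub)⟩

/-- For an essentially minimal zero-dimensional system on a nonempty space, every
continuous `f : X → ℤ` with `f ∘ h = f` is constant. -/
theorem stmt6 {X : Type*} [TopologicalSpace X] [CompactSpace X]
    [TopologicalSpace.MetrizableSpace X] [TotallyDisconnectedSpace X] [Nonempty X]
    (h : X ≃ₜ X) (hem : EssentiallyMinimal h)
    (f : X → ℤ) (hf : Continuous f) (hinv : f ∘ ⇑h = f) :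
    ∀ x y : X, f x = f y := by
  obtain ⟨Z, ⟨⟨z, hz⟩, -⟩, huniq⟩ := hem
  suffices H : ∀ x, f z = f x from fun x y => (H x).symm.trans (H y)
  intro x
  obtain ⟨Y, hne, hcl, hsub, hY⟩ := exists_isMinimalSubsetOf h (A := f ⁻¹' {f x}) ⟨x, rfl⟩
    (isClosed_singleton.preimage hf)
    ((image_eq_self_iff_forall_mem_iff h.toEquiv _).2 fun a => by
      have := congrFun hinv a
      simp_all)
  have hYZ : Y = Z := huniq Y ⟨hne, hcl, subset_univ Y, hY⟩
  exact hsub (hYZ ▸ hz)
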